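/- arXiv:1012.4140 — 7 statements merged into one kernel-verified Lean document; each statement's English description precedes it below -/
import Mathlib

section
/- Let n ≥ 2 and let A be a real n×n matrix whose off-diagonal entries are all strictly positive (A i j > 0 whenever i ≠ j), and suppose that the all-ones row vector is a left eigenvector of A with eigenvalue 0 (equivalently, every column of A sums to 0). Then 0 is a simple root of the characteristic polynomial of A, and every complex eigenvalue of A other than 0 has strictly negative real part. -/
open Polynomial Matrix

/-- `z : ℂ` is an eigenvalue of the real matrix `A` if it is a root of the
characteristic polynomial of `A`, regarded as a polynomial over `ℂ`. -/
def IsEigenvalue {n : ℕ} (A : Matrix (Fin n) (Fin n) ℝ) (z : ℂ) : Prop :=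
  ((A.charpoly).map (algebraMap ℝ ℂ)).IsRoot z

/-- If `B * A = 0`, then the characteristic polynomials of `B` and `A` multiply to that of
`A + B`, up to a power of `X`. -/
theorem Matrix.charpoly_mul_charpoly_of_mul_eq_zero {ι R : Type*} [Fintype ι] [DecidableEq ι]
    [CommRing R] {A B : Matrix ι ι R} (h : B * A = 0) :
    B.charpoly * A.charpoly = X ^ Fintype.card ι * (A + B).charpoly := by
  have hmap : B.map (C : R →+* R[X]) * A.map (C : R →+* R[X]) = 0 := by
    rw [← Matrix.map_mul, h, Matrix.map_zero _ (map_zero _)]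
  have key : charmatrix B * charmatrix A = (X : R[X]) • charmatrix (A + B) := by
    simp only [charmatrix, RingHom.mapMatrix_apply, sub_mul, mul_sub, hmap,
      Matrix.map_add _ (map_add (C : R →+* R[X])), scalar_apply,
      ← smul_one_eq_diagonal, smul_mul_assoc, mul_smul_comm, one_mul, mul_one, smul_add, smul_sub]
    abel
  rw [charpoly, charpoly, ← det_mul, key, det_smul, charpoly]

/-- A matrix with nonnegative off-diagonal entries and negative column sums is nonsingular. -/
theorem Matrix.det_ne_zero_of_offDiag_nonneg_of_sum_col_neg {ι : Type*} [Fintype ι] [DecidableEq ι]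
    {A : Matrix ι ι ℝ} (hoff : ∀ i j, i ≠ j → 0 ≤ A i j) (hcol : ∀ j, ∑ i, A i j < 0) :
    A.det ≠ 0 := by
  refine det_ne_zero_of_sum_col_lt_diag fun k => ?_
  have hsum : ∑ i ∈ Finset.univ.erase k, ‖A i k‖ = ∑ i ∈ Finset.univ.erase k, A i k :=
    Finset.sum_congr rfl fun i hi => Real.norm_of_nonneg (hoff i k (Finset.ne_of_mem_erase hi))
  have hk := hcol k
  rw [← Finset.add_sum_erase _ _ (Finset.mem_univ k)] at hk
  rw [hsum, Real.norm_eq_abs]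
  linarith [neg_abs_le (A k k)]

/-- Zero is a simple root of the characteristic polynomial of a matrix with positive off-diagonal
entries and zero column sums. -/
theorem Matrix.rootMultiplicity_zero_charpoly_of_sum_col_eq_zero {ι : Type*} [Fintype ι]
    [DecidableEq ι] [Nonempty ι] {A : Matrix ι ι ℝ} (hpos : ∀ i j, i ≠ j → 0 < A i j)
    (hcol : ∀ j, ∑ i, A i j = 0) : A.charpoly.rootMultiplicity 0 = 1 := by
  obtain ⟨ε, hε, hle⟩ : ∃ ε : ℝ, 0 < ε ∧ ∀ i j, i ≠ j → ε ≤ A i j := by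
    rcases isEmpty_or_nonempty {p : ι × ι // p.1 ≠ p.2} with he | hne
    · exact ⟨1, one_pos, fun i j hij => (he.false ⟨(i, j), hij⟩).elim⟩
    · obtain ⟨p, hp⟩ := Finite.exists_min fun p : {p : ι × ι // p.1 ≠ p.2} => A p.1.1 p.1.2
      exact ⟨_, hpos _ _ p.2, fun i j hij => hp ⟨(i, j), hij⟩⟩
  have hcard : 0 < Fintype.card ι := Fintype.card_pos
  set B : Matrix ι ι ℝ := vecMulVec (fun _ => -ε) 1 with hB
  have hBA : B * A = 0 := by
    ext i j
    simp [hB, mul_apply, ← Finset.mul_sum, hcol]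
  have hcharB : B.charpoly = X ^ (Fintype.card ι - 1) * (X - C (-(Fintype.card ι * ε))) := by
    rw [hB, charpoly_vecMulVec]
    obtain ⟨m, hm⟩ := Nat.exists_eq_succ_of_ne_zero hcard.ne'
    simp [hm, dotProduct, pow_succ, smul_eq_C_mul]
    ring
  have hdet : (A + B).det ≠ 0 := by
    refine det_ne_zero_of_offDiag_nonneg_of_sum_col_neg (fun i j hij => ?_) fun j => ?_
    · simpa [hB, vecMulVec_apply] using hle i j hij
    · simp [hB, Finset.sum_add_distrib, hcol, hε, hcard]
  have hroot : ¬ (A + B).charpoly.IsRoot 0 := by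
    rw [IsRoot, eval_charpoly, map_zero, zero_sub, det_neg]
    exact mul_ne_zero (pow_ne_zero _ (by norm_num)) hdet
  have hmul : (X - C (-(Fintype.card ι * ε))) * A.charpoly = (A + B).charpoly * (X - C 0) ^ 1 := by
    have h := charpoly_mul_charpoly_of_mul_eq_zero hBA
    rw [hcharB, ← Nat.sub_add_cancel hcard, pow_succ, Nat.add_sub_cancel, mul_assoc, mul_assoc,
      Nat.sub_add_cancel hcard] at h
    rw [mul_left_cancel₀ (pow_ne_zero _ X_ne_zero) h]
    simp [mul_comm]
  have hmult := congrArg (rootMultiplicity 0) hmul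
  rwa [rootMultiplicity_mul (mul_ne_zero (X_sub_C_ne_zero _) A.charpoly_monic.ne_zero),
    rootMultiplicity_mul_X_sub_C_pow (charpoly_monic _).ne_zero, rootMultiplicity_eq_zero hroot,
    rootMultiplicity_eq_zero (by simp [hε.ne', hcard.ne']), zero_add, zero_add] at hmult

/-- The nonzero complex eigenvalues of a real matrix with nonnegative off-diagonal entries and zero
column sums have negative real part. -/
theorem Matrix.re_neg_of_isRoot_charpoly_of_sum_col_eq_zero {ι : Type*} [Fintype ι] [DecidableEq ι]
    {A : Matrix ι ι ℝ} (hoff : ∀ i j, i ≠ j → 0 ≤ A i j) (hcol : ∀ j, ∑ i, A i j = 0) {z : ℂ}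
    (hroot : (A.charpoly.map (algebraMap ℝ ℂ)).IsRoot z) (hz : z ≠ 0) : z.re < 0 := by
  by_contra! hre
  rw [← charpoly_map, IsRoot, eval_charpoly] at hroot
  refine det_ne_zero_of_sum_col_lt_diag (fun k => ?_) hroot
  have hsum : ∑ i ∈ Finset.univ.erase k, ‖(scalar ι z - A.map (algebraMap ℝ ℂ)) i k‖ =
      ∑ i ∈ Finset.univ.erase k, A i k := by
    refine Finset.sum_congr rfl fun i hi => ?_
    have hik := Finset.ne_of_mem_erase hi
    simp [diagonal_apply_ne _ hik, abs_of_nonneg (hoff i k hik)]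
  have hnonneg : 0 ≤ ∑ i ∈ Finset.univ.erase k, A i k :=
    Finset.sum_nonneg fun i hi => hoff i k (Finset.ne_of_mem_erase hi)
  have hk := hcol k
  rw [← Finset.add_sum_erase _ _ (Finset.mem_univ k)] at hk
  have hnorm : 0 < z.re * z.re + z.im * z.im := by
    simpa [Complex.normSq_apply] using Complex.normSq_pos.mpr hz
  rw [hsum]
  refine lt_of_pow_lt_pow_left₀ 2 (norm_nonneg _) ?_
  rw [← Complex.normSq_eq_norm_sq, Complex.normSq_apply, eq_neg_of_add_eq_zero_right hk]
  simp
  nlinarith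

theorem stmt0 (n : ℕ) (hn : 2 ≤ n) (A : Matrix (Fin n) (Fin n) ℝ)
    (hpos : ∀ i j : Fin n, i ≠ j → 0 < A i j)
    (hcol : ∀ j : Fin n, ∑ i : Fin n, A i j = 0) :
    ((A.charpoly).map (algebraMap ℝ ℂ)).rootMultiplicity 0 = 1 ∧
    ∀ z : ℂ, IsEigenvalue A z → z ≠ 0 → z.re < 0 := by
  have : Nonempty (Fin n) := ⟨⟨0, by omega⟩⟩
  refine ⟨?_, fun z hroot hz => re_neg_of_isRoot_charpoly_of_sum_col_eq_zero
    (fun i j hij => (hpos i j hij).le) hcol hroot hz⟩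
  rw [← rootMultiplicity_zero_charpoly_of_sum_col_eq_zero hpos hcol,
    eq_rootMultiplicity_map (algebraMap ℝ ℂ).injective, map_zero]
end

section
/- Let n ≥ 2 and let μ₁,…,μₙ be strictly positive reals. Define the real n×n matrix A by A i i = −μᵢ·(n−1)/n on the diagonal and A i i' = μ_{i'}/n for i ≠ i'. Then 0 is a simple root of the characteristic polynomial of A, and every complex eigenvalue of A other than 0 has strictly negative real part. -/
open Polynomial Matrix

/-- If `A i j = μ j / n - δ i j * μ i`, the characteristic polynomial of `A` is
`(X / n) * ∑ i, ∏ j ≠ i, (X + μ j)`. -/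
theorem charpoly_eq_X_mul_sum_prod_erase {n : ℕ} (hn : n ≠ 0) (μ : Fin n → ℝ) (hμ : ∀ i, 0 < μ i)
    (A : Matrix (Fin n) (Fin n) ℝ)
    (hA : ∀ i j, A i j = μ j / n - if i = j then μ i else 0) :
    A.charpoly =
      X * (C (n : ℝ)⁻¹ * ∑ i, ∏ j ∈ Finset.univ.erase i, (X + C (μ j))) := by
  have hn' : (n : ℝ) ≠ 0 := Nat.cast_ne_zero.mpr hn
  refine Polynomial.eq_of_infinite_eval_eq _ _ ((Set.Ioi_infinite (0 : ℝ)).mono fun t ht => ?_)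
  have hd : ∀ i, t + μ i ≠ 0 := fun i => (add_pos ht (hμ i)).ne'
  have hmat : scalar (Fin n) t - A = diagonal (fun i => t + μ i) *
      (1 + replicateCol Unit (fun i => -((n : ℝ) * (t + μ i))⁻¹) * replicateRow Unit μ) := by
    ext i j
    have := hd i
    rw [diagonal_mul]
    by_cases hij : i = j
    · subst hij
      simp [hA, Matrix.mul_apply]
      field_simp
      ring
    · simp [hA, Matrix.mul_apply, hij]
      field_simp
  have herase : ∀ i, ∏ j ∈ Finset.univ.erase i, (t + μ j) =
      (∏ j, (t + μ j)) * (t + μ i)⁻¹ := fun i => by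
    rw [← Finset.mul_prod_erase _ _ (Finset.mem_univ i)]
    have := hd i
    field_simp
  have hsum : 1 + ∑ i, μ i * -((n : ℝ) * (t + μ i))⁻¹ = ∑ i, t * (n : ℝ)⁻¹ * (t + μ i)⁻¹ := by
    have hone : (1 : ℝ) = ∑ _i : Fin n, (n : ℝ)⁻¹ := by simp [hn']
    rw [hone, ← Finset.sum_add_distrib]
    refine Finset.sum_congr rfl fun i _ => ?_
    have := hd i
    field_simp
    ring
  rw [Set.mem_ofPred_eq, eval_charpoly, hmat, det_mul, det_diagonal,
    det_one_add_replicateCol_mul_replicateRow, dotProduct, hsum]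
  simp only [eval_mul, eval_X, eval_C, eval_finsetSum, eval_prod, eval_add, herase,
    ← Finset.mul_sum]
  ring

/-- If `a i > 0` for all `i`, then `∑ i, ∏ j ≠ i, (z + a j)` does not vanish on the closed right
half-plane. -/
theorem sum_prod_erase_ne_zero_of_re_nonneg {ι : Type*} [Fintype ι] [DecidableEq ι] [Nonempty ι]
    (a : ι → ℝ) (ha : ∀ i, 0 < a i) {z : ℂ} (hz : 0 ≤ z.re) :
    ∑ i, ∏ j ∈ Finset.univ.erase i, (z + (a j : ℂ)) ≠ 0 := by
  have hre : ∀ i, 0 < (z + (a i : ℂ)).re := fun i => by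
    simpa using add_pos_of_nonneg_of_pos hz (ha i)
  have hne : ∀ i, z + (a i : ℂ) ≠ 0 := fun i h => by simpa [h] using hre i
  have hfactor : ∑ i, ∏ j ∈ Finset.univ.erase i, (z + (a j : ℂ)) =
      (∏ j, (z + (a j : ℂ))) * ∑ i, (z + (a i : ℂ))⁻¹ := by
    rw [Finset.mul_sum]
    refine Finset.sum_congr rfl fun i _ => ?_
    rw [← Finset.mul_prod_erase _ _ (Finset.mem_univ i), mul_right_comm,
      mul_inv_cancel₀ (hne i), one_mul]
  rw [hfactor]
  refine mul_ne_zero (Finset.prod_ne_zero_iff.mpr fun i _ => hne i) fun h => ?_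
  have hpos : 0 < (∑ i, (z + (a i : ℂ))⁻¹).re := by
    rw [Complex.re_sum]
    refine Finset.sum_pos (fun i _ => ?_) Finset.univ_nonempty
    rw [Complex.inv_re]
    exact div_pos (hre i) (Complex.normSq_pos.mpr (hne i))
  simp [h] at hpos

theorem stmt1 (n : ℕ) (hn : 2 ≤ n) (μ : Fin n → ℝ) (hμ : ∀ i, 0 < μ i)
    (A : Matrix (Fin n) (Fin n) ℝ)
    (hA : ∀ i i' : Fin n,
      A i i' = if i = i' then -(μ i) * ((n : ℝ) - 1) / n else μ i' / n) :
    ((A.charpoly).map (algebraMap ℝ ℂ)).rootMultiplicity 0 = 1 ∧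
    ∀ z : ℂ, IsEigenvalue A z → z ≠ 0 → z.re < 0 := by
  have hn0 : n ≠ 0 := by omega
  have : Nonempty (Fin n) := ⟨⟨0, by omega⟩⟩
  have hchar := charpoly_eq_X_mul_sum_prod_erase hn0 μ hμ A fun i j => by
    have : (n : ℝ) ≠ 0 := Nat.cast_ne_zero.mpr hn0
    rw [hA]
    split_ifs with hij
    · subst hij
      field_simp
      ring
    · ring
  set q : ℝ[X] := C (n : ℝ)⁻¹ * ∑ i, ∏ j ∈ Finset.univ.erase i, (X + C (μ j)) with hq
  have hmap : A.charpoly.map (algebraMap ℝ ℂ) = X * q.map (algebraMap ℝ ℂ) := by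
    rw [hchar, Polynomial.map_mul, map_X]
  have hroot : ∀ z : ℂ, 0 ≤ z.re → ¬ (q.map (algebraMap ℝ ℂ)).IsRoot z := fun z hz h => by
    refine sum_prod_erase_ne_zero_of_re_nonneg μ hμ hz ?_
    simpa [hq, IsRoot.def, Polynomial.map_sum, Polynomial.map_prod, eval_finsetSum, eval_prod,
      hn0] using h
  refine ⟨?_, fun z hz hz0 => ?_⟩
  · have hne : X * q.map (algebraMap ℝ ℂ) ≠ 0 :=
      hmap ▸ (A.charpoly_monic.map (algebraMap ℝ ℂ)).ne_zero
    have hX : rootMultiplicity (0 : ℂ) X = 1 := by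
      simpa using rootMultiplicity_X_sub_C_self (x := (0 : ℂ))
    rw [hmap, rootMultiplicity_mul hne, hX, rootMultiplicity_eq_zero (hroot 0 le_rfl)]
  · by_contra! hre
    rw [IsEigenvalue, hmap, root_mul] at hz
    exact hz.elim (fun h => hz0 (by simpa using h)) (hroot z hre)
end

section
/- The real 3×3 matrix with rows (−1.99, −0.99, −0.99), (97.02, −2.98, −1.98), (96.03, 96.03, −3.97) has a complex eigenvalue with strictly positive real part. -/
open Polynomial Matrix

/-- A monic complex quadratic whose roots have a sum with positive real part has a root
with positive real part. -/
theorem exists_quadratic_root_re_pos (s q : ℂ) (hs : 0 < s.re) :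
    ∃ z : ℂ, z ^ 2 - s * z + q = 0 ∧ 0 < z.re := by
  obtain ⟨w, hw⟩ := IsAlgClosed.exists_pow_nat_eq (s ^ 2 / 4 - q) two_pos
  rcases le_total 0 w.re with h | h
  · refine ⟨s / 2 + w, by linear_combination hw, ?_⟩
    simp only [Complex.add_re, Complex.div_ofNat_re]
    linarith
  · refine ⟨s / 2 - w, by linear_combination hw, ?_⟩
    simp only [Complex.sub_re, Complex.div_ofNat_re]
    linarith

/-- A cubic violating the Routh–Hurwitz condition has a root with positive real part. -/
theorem exists_cubic_root_re_pos (a b c : ℝ) (hb : 0 < b) (h : a * b < c) :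
    ∃ z : ℂ, z ^ 3 + a * z ^ 2 + b * z + c = 0 ∧ 0 < z.re := by
  have hcb : a < c / b := by rwa [lt_div_iff₀ hb]
  have hc : b * (c / b) = c := mul_div_cancel₀ c hb.ne'
  obtain ⟨r, ⟨-, hr⟩, hr0⟩ : ∃ r ∈ Set.Ico (-(c / b)) (-a),
      r ^ 3 + a * r ^ 2 + b * r + c = 0 := by
    refine intermediate_value_Ico (f := fun x : ℝ ↦ x ^ 3 + a * x ^ 2 + b * x + c)
      (neg_le_neg hcb.le) (by fun_prop) ⟨?_, ?_⟩
    · have : 0 ≤ (c / b) ^ 2 * (c / b - a) :=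
        mul_nonneg (sq_nonneg _) (sub_nonneg.2 hcb.le)
      linarith
    · linarith
  obtain ⟨z, hz, hz0⟩ := exists_quadratic_root_re_pos ((-(a + r) : ℝ) : ℂ)
    ((b + r * (a + r) : ℝ) : ℂ) (by rw [Complex.ofReal_re]; linarith)
  refine ⟨z, ?_, hz0⟩
  have hr1 : (r : ℂ) ^ 3 + a * r ^ 2 + b * r + c = 0 := by exact_mod_cast hr0
  push_cast at hz
  linear_combination (z - r) * hz + hr1

theorem stmt9 :
    ∃ z : ℂ,
      IsEigenvalue
        !![(-1.99 : ℝ), -0.99, -0.99;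
           97.02, -2.98, -1.98;
           96.03, 96.03, -3.97] z ∧ 0 < z.re := by
  obtain ⟨z, hz, hz0⟩ := exists_cubic_root_re_pos 8.94 406.92 10101.97
    (by norm_num) (by norm_num)
  refine ⟨z, ?_, hz0⟩
  push_cast at hz
  rw [IsEigenvalue, IsRoot.def, ← Matrix.charpoly_map, Matrix.eval_charpoly, det_fin_three]
  simp [Matrix.scalar_apply]
  linear_combination hz
end

section
/- Let A be 1/20 times the integer 5×5 matrix with rows (9389, 9805, 10201, 10597, −29003), (10894, 9290, 9706, 10102, −29498), (10399, 10795, 9191, 9607, −29993), (−40091, −39695, −39299, −40903, 119497), (9409, 9805, 10201, 10597, −31003). Then 0 is an eigenvalue of A (indeed every column of A sums to 0, so (1,1,1,1,1) is a left eigenvector with eigenvalue 0), and A has a complex eigenvalue with strictly positive real part. -/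
open Polynomial Matrix

/-- A complex number is an eigenvalue iff it is a zero of the characteristic determinant. -/
lemma isEigenvalue_iff_det {n : ℕ} (A : Matrix (Fin n) (Fin n) ℝ) (z : ℂ) :
    IsEigenvalue A z ↔ (Matrix.scalar (Fin n) z - A.map (algebraMap ℝ ℂ)).det = 0 := by
  rw [IsEigenvalue, ← Matrix.charpoly_map, Polynomial.IsRoot, Matrix.eval_charpoly]

/-- If a monic real quartic has two distinct real roots whose sum is smaller than the sum of
all four roots, then it has a complex root with positive real part. -/
lemma exists_quartic_root_re_pos {a b c d x y : ℝ} (hxy : x ≠ y)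
    (hx : x ^ 4 + a * x ^ 3 + b * x ^ 2 + c * x + d = 0)
    (hy : y ^ 4 + a * y ^ 3 + b * y ^ 2 + c * y + d = 0) (hsum : a + x + y < 0) :
    ∃ z : ℂ, z ^ 4 + a * z ^ 3 + b * z ^ 2 + c * z + d = 0 ∧ 0 < z.re := by
  set p : ℝ := a + x + y with hp
  set s : ℝ := b + a * (x + y) + x ^ 2 + x * y + y ^ 2 with hs
  have root : ∀ z : ℂ, z ^ 2 + p * z + s = 0 →
      z ^ 4 + a * z ^ 3 + b * z ^ 2 + c * z + d = 0 := by
    intro z hz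
    have hne : (x : ℂ) - y ≠ 0 := sub_ne_zero.mpr (by exact_mod_cast hxy)
    have hx' : (x : ℂ) ^ 4 + a * x ^ 3 + b * x ^ 2 + c * x + d = 0 := by exact_mod_cast hx
    have hy' : (y : ℂ) ^ 4 + a * y ^ 3 + b * y ^ 2 + c * y + d = 0 := by exact_mod_cast hy
    rw [hp, hs] at hz
    push_cast at hz
    apply (mul_eq_zero.mp _).resolve_left hne
    linear_combination (x - y : ℂ) * (z - x) * (z - y) * hz + (z - y) * hx' - (z - x) * hy'
  obtain ⟨w, hw⟩ := IsAlgClosed.exists_pow_nat_eq ((p / 2 : ℂ) ^ 2 - s) (n := 2) (by norm_num)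
  have hre : ((p : ℂ) / 2).re = p / 2 := by simp
  rcases le_total 0 w.re with h | h
  · refine ⟨-(p / 2) + w, root _ (by linear_combination hw), ?_⟩
    rw [Complex.add_re, Complex.neg_re, hre]
    linarith
  · refine ⟨-(p / 2) - w, root _ (by linear_combination hw), ?_⟩
    rw [Complex.sub_re, Complex.neg_re, hre]
    linarith

theorem stmt10 (A : Matrix (Fin 5) (Fin 5) ℝ)
    (hA : A = (1 / 20 : ℝ) •
      !![(9389 : ℝ), 9805, 10201, 10597, -29003;
         10894, 9290, 9706, 10102, -29498;
         10399, 10795, 9191, 9607, -29993;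
         -40091, -39695, -39299, -40903, 119497;
         9409, 9805, 10201, 10597, -31003]) :
    (∀ j : Fin 5, ∑ i : Fin 5, A i j = 0) ∧
    IsEigenvalue A 0 ∧
    ∃ z : ℂ, IsEigenvalue A z ∧ 0 < z.re := by
  have key : ∀ z : ℂ, IsEigenvalue A z ↔
      z * (z ^ 4 + (11009 / 5 : ℝ) * z ^ 3 + (131007 / 5 : ℝ) * z ^ 2
        + (5080502 / 5 : ℝ) * z + (20204020 : ℝ)) = 0 := by
    intro z
    rw [isEigenvalue_iff_det, hA]
    refine Eq.congr ?_ rfl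
    simp [Matrix.det_succ_row_zero, Fin.sum_univ_succ, Fin.succAbove, Matrix.scalar_apply,
      Matrix.diagonal_apply]
    ring
  refine ⟨?_, (key 0).mpr (zero_mul _), ?_⟩
  · intro j
    subst hA
    fin_cases j <;> simp [Fin.sum_univ_succ] <;> norm_num
  · let f : ℝ → ℝ := fun x ↦
      x ^ 4 + 11009 / 5 * x ^ 3 + 131007 / 5 * x ^ 2 + 5080502 / 5 * x + 20204020
    have hf : Continuous f := by fun_prop
    obtain ⟨x, hx, hfx⟩ := intermediate_value_Icc' (show (-2191 : ℝ) ≤ -2190 by norm_num)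
      hf.continuousOn (show (0 : ℝ) ∈ _ by constructor <;> norm_num [f])
    obtain ⟨y, hy, hfy⟩ := intermediate_value_Icc (show (-17 : ℝ) ≤ -16 by norm_num)
      hf.continuousOn (show (0 : ℝ) ∈ _ by constructor <;> norm_num [f])
    obtain ⟨z, hz, hpos⟩ := exists_quartic_root_re_pos
      (by linarith [hx.2, hy.1] : x < y).ne hfx hfy (by linarith [hx.2, hy.2])
    exact ⟨z, (key z).mpr (by rw [hz, mul_zero]), hpos⟩
end

section
/- Let ι and κ be finite nonempty sets and let G be a graph on the disjoint union ι ⊕ κ, all of whose edges join a vertex of ι to a vertex of κ, and which is a tree (connected and acyclic). Let c : κ → ℝ and d : ι → ℝ satisfy Σ_{i∈ι} d(i) = Σ_{j∈κ} c(j). Then there exists a unique function z : ι × κ → ℝ such that z(i,j) = 0 whenever i and j are not adjacent in G, Σ_{j∈κ} z(i,j) = d(i) for every i ∈ ι, and Σ_{i∈ι} z(i,j) = c(j) for every j ∈ κ. -/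
namespace SimpleGraph

variable {V : Type*} [Fintype V] (G : SimpleGraph V)

/-- A flow on `G` with net outflow `b`: an antisymmetric function supported on the edges of `G`
whose sum over the second argument is `b`. -/
structure IsFlow (f : V → V → ℝ) (b : V → ℝ) : Prop where
  antisymm : ∀ x y, f x y = -f y x
  eq_zero_of_not_adj : ∀ x y, ¬ G.Adj x y → f x y = 0
  sum_eq : ∀ x, ∑ y, f x y = b x

variable {G}

lemma IsFlow.zero : G.IsFlow 0 0 where
  antisymm := by simp
  eq_zero_of_not_adj := by simp
  sum_eq := by simp

lemma IsFlow.add {f g : V → V → ℝ} {a b : V → ℝ} (hf : G.IsFlow f a) (hg : G.IsFlow g b) :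
    G.IsFlow (f + g) (a + b) where
  antisymm x y := by
    simp only [Pi.add_apply]
    linarith [hf.antisymm x y, hg.antisymm x y]
  eq_zero_of_not_adj x y h := by
    simp [hf.eq_zero_of_not_adj x y h, hg.eq_zero_of_not_adj x y h]
  sum_eq x := by simp [Finset.sum_add_distrib, hf.sum_eq, hg.sum_eq]

lemma IsFlow.smul {f : V → V → ℝ} {b : V → ℝ} (r : ℝ) (hf : G.IsFlow f b) :
    G.IsFlow (r • f) (r • b) where
  antisymm x y := by
    simp only [Pi.smul_apply, smul_eq_mul]
    rw [hf.antisymm x y, mul_neg]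
  eq_zero_of_not_adj x y h := by simp [hf.eq_zero_of_not_adj x y h]
  sum_eq x := by simp [← Finset.mul_sum, hf.sum_eq]

lemma IsFlow.exists_sum {α : Type*} (s : Finset α) {b : α → V → ℝ}
    (h : ∀ a ∈ s, ∃ f, G.IsFlow f (b a)) : ∃ f, G.IsFlow f (∑ a ∈ s, b a) := by
  refine Finset.sum_induction b (fun b ↦ ∃ f, G.IsFlow f b) ?_ ⟨0, .zero⟩ h
  rintro a b ⟨f, hf⟩ ⟨g, hg⟩
  exact ⟨f + g, hf.add hg⟩

lemma Adj.exists_isFlow [DecidableEq V] {u v : V} (h : G.Adj u v) :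
    ∃ f, G.IsFlow f (Pi.single u 1 - Pi.single v 1) := by
  refine ⟨fun x y ↦ (if x = u ∧ y = v then 1 else 0) - (if x = v ∧ y = u then 1 else 0),
    ⟨fun x y ↦ ?_, fun x y hxy ↦ ?_, fun x ↦ ?_⟩⟩
  · simp [and_comm]
  · have h₁ : ¬ (x = u ∧ y = v) := by
      rintro ⟨rfl, rfl⟩
      exact hxy h
    have h₂ : ¬ (x = v ∧ y = u) := by
      rintro ⟨rfl, rfl⟩
      exact hxy h.symm
    simp [h₁, h₂]
  · simp [Finset.sum_sub_distrib, ite_and, Pi.single_apply]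

lemma Reachable.exists_isFlow [DecidableEq V] {u v : V} (h : G.Reachable u v) :
    ∃ f, G.IsFlow f (Pi.single u 1 - Pi.single v 1) := by
  obtain ⟨p⟩ := h
  induction p with
  | nil => exact ⟨0, by simpa using IsFlow.zero⟩
  | cons h _ ih =>
    obtain ⟨f, hf⟩ := h.exists_isFlow
    obtain ⟨g, hg⟩ := ih
    exact ⟨f + g, by simpa using hf.add hg⟩

/-- On a connected graph every function of total sum zero is the net outflow of a flow. -/
lemma Connected.exists_isFlow (hG : G.Connected) {b : V → ℝ} (hb : ∑ x, b x = 0) :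
    ∃ f, G.IsFlow f b := by
  classical
  obtain ⟨r⟩ := hG.nonempty
  have key : b = ∑ u, b u • (Pi.single u 1 - Pi.single r 1 : V → ℝ) := by
    ext x
    simp [mul_sub, Finset.sum_sub_distrib, hb, Pi.single_apply]
  rw [key]
  refine IsFlow.exists_sum _ fun u _ ↦ ?_
  obtain ⟨f, hf⟩ := (hG.preconnected u r).exists_isFlow
  exact ⟨_, hf.smul (b u)⟩

/-- A flow without net outflow on an acyclic graph vanishes: each edge is a bridge, and
the value on it is the net outflow of one of the two sides. -/
lemma IsAcyclic.eq_zero_of_isFlow (hG : G.IsAcyclic) {f : V → V → ℝ} (hf : G.IsFlow f 0) :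
    f = 0 := by
  classical
  ext u v
  by_cases huv : G.Adj u v
  swap
  · exact hf.eq_zero_of_not_adj u v huv
  have hbr := isAcyclic_iff_forall_adj_isBridge.1 hG huv
  rw [isBridge_iff] at hbr
  set H := G.deleteEdges {s(u, v)} with hH
  let χ : V → ℝ := fun x ↦ if H.Reachable u x then 1 else 0
  have hu : χ u = 1 := if_pos (Reachable.refl u)
  have hv : χ v = 0 := if_neg hbr
  have hterm (x y : V) : (χ x - χ y) * f x y =
      (if x = u ∧ y = v then f u v else 0) + (if x = v ∧ y = u then f u v else 0) := by
    by_cases h₁ : x = u ∧ y = v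
    · obtain ⟨rfl, rfl⟩ := h₁
      simp [hu, hv, huv.ne]
    by_cases h₂ : x = v ∧ y = u
    · obtain ⟨rfl, rfl⟩ := h₂
      simp [hu, hv, huv.ne, hf.antisymm x y]
    by_cases hxy : G.Adj x y
    · have hadj : H.Adj x y := by
        simp [hH, deleteEdges_adj, hxy, h₁, h₂]
      have hχ : χ x = χ y := by
        have : H.Reachable u x ↔ H.Reachable u y :=
          ⟨fun h ↦ h.trans hadj.reachable, fun h ↦ h.trans hadj.symm.reachable⟩
        simp [χ, this]
      simp [hχ, h₁, h₂]
    · simp [hf.eq_zero_of_not_adj x y hxy, h₁, h₂]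
  have hleft : ∑ x, ∑ y, χ x * f x y = 0 := by
    simp [← Finset.mul_sum, hf.sum_eq]
  have hright : ∑ x, ∑ y, χ y * f x y = 0 := by
    rw [Finset.sum_comm]
    rw [← neg_eq_zero, ← hleft]
    simp_rw [← Finset.sum_neg_distrib, ← mul_neg]
    exact Finset.sum_congr rfl fun x _ ↦ Finset.sum_congr rfl fun y _ ↦ by
      rw [hf.antisymm x y]
  have htotal : ∑ x, ∑ y, (χ x - χ y) * f x y = 0 := by
    simp_rw [sub_mul, Finset.sum_sub_distrib, hleft, hright, sub_zero]
  simp_rw [hterm, Finset.sum_add_distrib, ite_and] at htotal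
  simpa using htotal

end SimpleGraph

theorem stmt13 (ι κ : Type*) [Fintype ι] [Fintype κ] [Nonempty ι] [Nonempty κ]
    (G : SimpleGraph (ι ⊕ κ))
    (hbip₁ : ∀ i i' : ι, ¬ G.Adj (Sum.inl i) (Sum.inl i'))
    (hbip₂ : ∀ j j' : κ, ¬ G.Adj (Sum.inr j) (Sum.inr j'))
    (htree : G.IsTree)
    (c : κ → ℝ) (d : ι → ℝ)
    (hbal : ∑ i : ι, d i = ∑ j : κ, c j) :
    ∃! z : ι × κ → ℝ,
      (∀ i j, ¬ G.Adj (Sum.inl i) (Sum.inr j) → z (i, j) = 0) ∧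
      (∀ i, ∑ j : κ, z (i, j) = d i) ∧
      (∀ j, ∑ i : ι, z (i, j) = c j) := by
  refine existsUnique_of_exists_of_unique ?_ ?_
  · obtain ⟨f, hf⟩ := htree.connected.exists_isFlow (b := Sum.elim d (-c)) (by simp [hbal])
    refine ⟨fun p ↦ f (Sum.inl p.1) (Sum.inr p.2),
      fun i j h ↦ hf.eq_zero_of_not_adj _ _ h, fun i ↦ ?_, fun j ↦ ?_⟩
    · simpa [hf.eq_zero_of_not_adj _ _ (hbip₁ i _)] using hf.sum_eq (Sum.inl i)
    · have h := hf.sum_eq (Sum.inr j)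
      simp only [Fintype.sum_sum_type, hf.eq_zero_of_not_adj _ _ (hbip₂ j _),
        hf.antisymm (Sum.inr j) (Sum.inl _)] at h
      simpa using h
  · rintro z z' ⟨hz, hzd, hzc⟩ ⟨hz', hzd', hzc'⟩
    let f : ι ⊕ κ → ι ⊕ κ → ℝ := Sum.elim
      (fun i ↦ Sum.elim 0 fun j ↦ z (i, j) - z' (i, j))
      (fun j ↦ Sum.elim (fun i ↦ -(z (i, j) - z' (i, j))) 0)
    have hf : G.IsFlow f 0 := by
      refine ⟨?_, ?_, ?_⟩
      · rintro (i | j) (i' | j') <;> simp [f]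
      · rintro (i | j) (i' | j') h
        · simp [f]
        · simp [f, hz _ _ h, hz' _ _ h]
        · simp [f, hz _ _ (mt G.adj_symm h), hz' _ _ (mt G.adj_symm h)]
        · simp [f]
      · rintro (i | j)
        · simp [f, hzd, hzd']
        · simp [f, hzc, hzc']
    ext ⟨i, j⟩
    have h := congrFun (congrFun (htree.isAcyclic.eq_zero_of_isFlow hf) (Sum.inl i)) (Sum.inr j)
    exact sub_eq_zero.1 h
end

section
/- Let ι and κ be finite nonempty sets and let G be a graph on the disjoint union ι ⊕ κ, all of whose edges join a vertex of ι to a vertex of κ, and which is a tree (connected and acyclic). Let μ : ι × κ → ℝ satisfy μ(i,j) > 0 for every edge (i,j) of G, and let β : κ → ℝ be strictly positive. Then for every d : ι → ℝ there exist a unique real number ρ̂ and a unique function ψ : ι × κ → ℝ with ψ(i,j) = 0 whenever i and j are not adjacent in G, such that Σ_{j∈κ} μ(i,j)·ψ(i,j) = d(i) for every i ∈ ι and Σ_{i∈ι} ψ(i,j) = ρ̂·β(j) for every j ∈ κ. -/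
/-- The edges of a bipartite graph on `ι ⊕ κ`, as pairs in `ι × κ`. -/
abbrev BipartiteEdge {ι κ : Type*} (G : SimpleGraph (ι ⊕ κ)) : Type _ :=
  {p : ι × κ // G.Adj (Sum.inl p.1) (Sum.inr p.2)}

lemma card_bipartiteEdge_eq_card_edgeSet {ι κ : Type*} {G : SimpleGraph (ι ⊕ κ)}
    (hbip₁ : ∀ i i' : ι, ¬ G.Adj (Sum.inl i) (Sum.inl i'))
    (hbip₂ : ∀ j j' : κ, ¬ G.Adj (Sum.inr j) (Sum.inr j')) :
    Nat.card (BipartiteEdge G) = Nat.card G.edgeSet := by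
  refine Nat.card_congr (Equiv.ofBijective
    (fun e ↦ ⟨s(Sum.inl e.1.1, Sum.inr e.1.2), e.2⟩) ⟨?_, ?_⟩)
  · rintro ⟨⟨i, j⟩, h⟩ ⟨⟨i', j'⟩, h'⟩ heq
    simpa using congrArg Subtype.val heq
  · rintro ⟨e, he⟩
    induction e with
    | _ u v =>
      rw [SimpleGraph.mem_edgeSet] at he
      rcases u with i | j <;> rcases v with i' | j'
      · exact absurd he (hbip₁ _ _)
      · exact ⟨⟨(i, j'), he⟩, rfl⟩
      · exact ⟨⟨(i', j), he.symm⟩, Subtype.ext Sym2.eq_swap⟩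
      · exact absurd he (hbip₂ _ _)

/-- A function on the vertices of a connected graph that is constant along edges is constant. -/
lemma SimpleGraph.Connected.apply_eq_of_forall_adj {V α : Type*} {G : SimpleGraph V}
    (hG : G.Connected) {f : V → α} (hf : ∀ u v, G.Adj u v → f u = f v) (u v : V) :
    f u = f v := by
  obtain ⟨p⟩ := hG u v
  induction p with
  | nil => rfl
  | cons h _ ih => exact (hf _ _ h).trans ih

/-- The transpose of the occupancy system of a connected bipartite graph has trivial kernel. -/
lemma eq_zero_of_forall_adj_mul_add_eq_zero {ι κ : Type*} [Fintype κ] [Nonempty κ]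
    {G : SimpleGraph (ι ⊕ κ)}
    (hbip₁ : ∀ i i' : ι, ¬ G.Adj (Sum.inl i) (Sum.inl i'))
    (hbip₂ : ∀ j j' : κ, ¬ G.Adj (Sum.inr j) (Sum.inr j'))
    (hconn : G.Connected)
    {μ : ι × κ → ℝ} (hμ : ∀ i j, G.Adj (Sum.inl i) (Sum.inr j) → 0 < μ (i, j))
    {β : κ → ℝ} (hβ : ∀ j, 0 < β j) {x : ι → ℝ} {y : κ → ℝ}
    (hxy : ∀ i j, G.Adj (Sum.inl i) (Sum.inr j) → μ (i, j) * x i + y j = 0)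
    (hy : ∑ j, β j * y j = 0) : x = 0 ∧ y = 0 := by
  set f : ι ⊕ κ → SignType := Sum.elim (fun i ↦ SignType.sign (x i)) (fun j ↦ SignType.sign (-y j))
    with hf_def
  have hedge : ∀ i j, G.Adj (Sum.inl i) (Sum.inr j) → f (Sum.inl i) = f (Sum.inr j) := by
    intro i j h
    have : -y j = μ (i, j) * x i := by linarith [hxy i j h]
    simp [hf_def, this, sign_mul, sign_pos (hμ i j h)]
  have hconst : ∀ u v, f u = f v := by
    refine hconn.apply_eq_of_forall_adj ?_
    rintro (i | j) (i' | j') h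
    · exact absurd h (hbip₁ _ _)
    · exact hedge _ _ h
    · exact (hedge _ _ h.symm).symm
    · exact absurd h (hbip₂ _ _)
  obtain ⟨j₀⟩ := ‹Nonempty κ›
  have hzero : f (Sum.inr j₀) = 0 := by
    rcases SignType.trichotomy (f (Sum.inr j₀)) with h | h | h
    · have hpos : ∀ j, 0 < y j := fun j ↦ by
        simpa [hf_def, sign_eq_neg_one_iff] using (hconst (Sum.inr j) (Sum.inr j₀)).trans h
      exact absurd hy (Finset.sum_pos (fun j _ ↦ mul_pos (hβ j) (hpos j)) ⟨j₀, by simp⟩).ne'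
    · exact h
    · have hneg : ∀ j, y j < 0 := fun j ↦ by
        simpa [hf_def, sign_eq_one_iff] using (hconst (Sum.inr j) (Sum.inr j₀)).trans h
      exact absurd hy
        (Finset.sum_neg (fun j _ ↦ mul_neg_of_pos_of_neg (hβ j) (hneg j)) ⟨j₀, by simp⟩).ne
  constructor
  · funext i
    simpa [hf_def] using (hconst (Sum.inl i) (Sum.inr j₀)).trans hzero
  · funext j
    simpa [hf_def] using (hconst (Sum.inr j) (Sum.inr j₀)).trans hzero

lemma extendByZero_apply_of_not_adj {ι κ : Type*} {G : SimpleGraph (ι ⊕ κ)}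
    (φ : BipartiteEdge G → ℝ) {p : ι × κ} (hp : ¬ G.Adj (Sum.inl p.1) (Sum.inr p.2)) :
    Function.ExtendByZero.linearMap ℝ Subtype.val φ p = 0 := by
  rw [Function.ExtendByZero.linearMap_apply, Function.extend_apply']
  · rfl
  · rintro ⟨e, rfl⟩
    exact hp e.2

lemma extendByZero_restrict {ι κ : Type*} {G : SimpleGraph (ι ⊕ κ)} {ψ : ι × κ → ℝ}
    (hψ : ∀ i j, ¬ G.Adj (Sum.inl i) (Sum.inr j) → ψ (i, j) = 0) :
    Function.ExtendByZero.linearMap ℝ Subtype.val (fun e : BipartiteEdge G ↦ ψ e.1) = ψ := by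
  funext p
  by_cases hp : G.Adj (Sum.inl p.1) (Sum.inr p.2)
  · exact Subtype.val_injective.extend_apply (fun e : BipartiteEdge G ↦ ψ e.1) 0 ⟨p, hp⟩
  · exact (extendByZero_apply_of_not_adj _ hp).trans (hψ p.1 p.2 hp).symm

lemma extendByZero_single {ι κ : Type*} {G : SimpleGraph (ι ⊕ κ)}
    [DecidableEq ι] [DecidableEq κ] [DecidableEq (BipartiteEdge G)] (e : BipartiteEdge G) :
    Function.ExtendByZero.linearMap ℝ Subtype.val (Pi.single e (1 : ℝ)) = Pi.single e.1 1 := by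
  have hrestrict : (Pi.single e (1 : ℝ) : BipartiteEdge G → ℝ) =
      fun e' ↦ (Pi.single e.1 1 : ι × κ → ℝ) e'.1 := by
    funext e'
    simp [Pi.single_apply, Subtype.ext_iff]
  rw [hrestrict]
  exact extendByZero_restrict fun i j h ↦
    Pi.single_eq_of_ne (fun he ↦ h (by simpa [← he] using e.2)) _

/-- The linear map sending the pool load and the edge occupancies to the residuals of the
class equations and the pool equations. -/
noncomputable def occupancyMap {ι κ : Type*} [Fintype ι] [Fintype κ] (G : SimpleGraph (ι ⊕ κ))
    (μ : ι × κ → ℝ) (β : κ → ℝ) :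
    ℝ × (BipartiteEdge G → ℝ) →ₗ[ℝ] (ι → ℝ) × (κ → ℝ) where
  toFun p :=
    (fun i ↦ ∑ j, μ (i, j) * Function.ExtendByZero.linearMap ℝ Subtype.val p.2 (i, j),
     fun j ↦ ∑ i, Function.ExtendByZero.linearMap ℝ Subtype.val p.2 (i, j) - p.1 * β j)
  map_add' p q := by
    ext
    · simp only [Prod.snd_add, map_add, Pi.add_apply, Prod.mk_add_mk, mul_add,
        Finset.sum_add_distrib]
    · simp only [Prod.fst_add, Prod.snd_add, map_add, Pi.add_apply, Prod.mk_add_mk,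
        Finset.sum_add_distrib]
      ring
  map_smul' c p := by
    ext
    · simp only [Prod.smul_snd, map_smul, Pi.smul_apply, Prod.smul_mk, smul_eq_mul,
        RingHom.id_apply, Finset.mul_sum, mul_left_comm]
    · simp only [Prod.smul_fst, Prod.smul_snd, map_smul, Pi.smul_apply, Prod.smul_mk, smul_eq_mul,
        RingHom.id_apply, ← Finset.mul_sum]
      ring

section occupancyMap

variable {ι κ : Type*} [Fintype ι] [Fintype κ] {G : SimpleGraph (ι ⊕ κ)}
  {μ : ι × κ → ℝ} {β : κ → ℝ}

lemma occupancyMap_one_zero : occupancyMap G μ β (1, 0) = (0, -β) := by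
  ext <;> simp [occupancyMap, -Function.ExtendByZero.linearMap_apply]

lemma occupancyMap_zero_single [DecidableEq ι] [DecidableEq κ] [DecidableEq (BipartiteEdge G)]
    (e : BipartiteEdge G) :
    occupancyMap G μ β (0, Pi.single e 1) =
      (μ e.1 • Pi.single e.1.1 1, Pi.single e.1.2 1) := by
  obtain ⟨⟨i, j⟩, he⟩ := e
  ext k
  · by_cases hk : k = i <;>
      simp [occupancyMap, extendByZero_single, -Function.ExtendByZero.linearMap_apply,
        Pi.single_apply, hk]
  · by_cases hk : k = j <;>
      simp [occupancyMap, extendByZero_single, -Function.ExtendByZero.linearMap_apply,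
        Pi.single_apply, Finset.filter_eq', hk]

lemma occupancyMap_bijective [Nonempty κ]
    (hbip₁ : ∀ i i' : ι, ¬ G.Adj (Sum.inl i) (Sum.inl i'))
    (hbip₂ : ∀ j j' : κ, ¬ G.Adj (Sum.inr j) (Sum.inr j'))
    (htree : G.IsTree) (hμ : ∀ i j, G.Adj (Sum.inl i) (Sum.inr j) → 0 < μ (i, j))
    (hβ : ∀ j, 0 < β j) : Function.Bijective (occupancyMap G μ β) := by
  classical
  have hsurj : Function.Surjective (occupancyMap G μ β) := by
    rw [← LinearMap.range_eq_top]
    by_contra hne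
    obtain ⟨f, hf0, hf⟩ := Submodule.exists_le_ker_of_lt_top _ (lt_top_iff_ne_top.2 hne)
    have hker : ∀ p, f (occupancyMap G μ β p) = 0 := fun p ↦ hf ⟨p, rfl⟩
    have hzero := eq_zero_of_forall_adj_mul_add_eq_zero hbip₁ hbip₂ htree.connected hμ hβ
      (x := fun i ↦ f (Pi.single i 1, 0)) (y := fun j ↦ f (0, Pi.single j 1)) ?_ ?_
    · refine hf0 (LinearMap.prod_ext (LinearMap.pi_ext' fun i ↦ LinearMap.ext_ring ?_)
        (LinearMap.pi_ext' fun j ↦ LinearMap.ext_ring ?_))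
      · simpa using congrFun hzero.1 i
      · simpa using congrFun hzero.2 j
    · intro i j h
      have := hker (0, Pi.single ⟨(i, j), h⟩ 1)
      rw [occupancyMap_zero_single] at this
      rw [← this, ← smul_eq_mul, ← map_smul, ← map_add]
      simp
    · have h := hker (1, 0)
      have hsum : ((0 : ι → ℝ), β) = ∑ j, β j • ((0 : ι → ℝ), Pi.single j (1 : ℝ)) := by
        ext k
        · simp [Prod.fst_sum]
        · simp [Prod.snd_sum, Finset.sum_apply, Pi.single_apply]
      have hneg : ((0 : ι → ℝ), -β) = -((0 : ι → ℝ), β) := by simp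
      rw [occupancyMap_one_zero, hneg, map_neg, neg_eq_zero, hsum, map_sum] at h
      simpa only [map_smul, smul_eq_mul] using h
  refine ⟨(LinearMap.injective_iff_surjective_of_finrank_eq_finrank ?_).2 hsurj, hsurj⟩
  have hcard := (SimpleGraph.isTree_iff_connected_and_card.1 htree).2
  rw [← card_bipartiteEdge_eq_card_edgeSet hbip₁ hbip₂] at hcard
  simp only [Nat.card_eq_fintype_card, Fintype.card_sum] at hcard
  simp only [Module.finrank_prod, Module.finrank_self, Module.finrank_fintype_fun_eq_card]
  omega

end occupancyMap

theorem stmt14 (ι κ : Type*) [Fintype ι] [Fintype κ] [Nonempty ι] [Nonempty κ]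
    (G : SimpleGraph (ι ⊕ κ))
    (hbip₁ : ∀ i i' : ι, ¬ G.Adj (Sum.inl i) (Sum.inl i'))
    (hbip₂ : ∀ j j' : κ, ¬ G.Adj (Sum.inr j) (Sum.inr j'))
    (htree : G.IsTree)
    (μ : ι × κ → ℝ) (hμ : ∀ i j, G.Adj (Sum.inl i) (Sum.inr j) → 0 < μ (i, j))
    (β : κ → ℝ) (hβ : ∀ j, 0 < β j) :
    ∀ d : ι → ℝ,
      ∃! p : ℝ × (ι × κ → ℝ),
        (∀ i j, ¬ G.Adj (Sum.inl i) (Sum.inr j) → p.2 (i, j) = 0) ∧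
        (∀ i, ∑ j : κ, μ (i, j) * p.2 (i, j) = d i) ∧
        (∀ j, ∑ i : ι, p.2 (i, j) = p.1 * β j) := by
  intro d
  obtain ⟨p, hp, hunique⟩ :=
    (occupancyMap_bijective hbip₁ hbip₂ htree hμ hβ).existsUnique (d, 0)
  refine ⟨(p.1, Function.ExtendByZero.linearMap ℝ Subtype.val p.2), ⟨?_, ?_, ?_⟩, ?_⟩
  · exact fun i j h ↦ extendByZero_apply_of_not_adj _ h
  · exact fun i ↦ congrFun (congrArg Prod.fst hp) i
  · exact fun j ↦ sub_eq_zero.1 (congrFun (congrArg Prod.snd hp) j)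
  · rintro ⟨ρ, ψ⟩ ⟨hsupp, hclass, hpool⟩
    have hext := extendByZero_restrict hsupp
    have hp' := hunique (ρ, fun e ↦ ψ e.1) (by
      ext k
      · simpa only [occupancyMap, LinearMap.coe_mk, AddHom.coe_mk, hext] using hclass k
      · simpa only [occupancyMap, LinearMap.coe_mk, AddHom.coe_mk, hext, Pi.zero_apply] using
          sub_eq_zero.2 (hpool k))
    rw [← hp', hext]
end

section
/- Let (mₙ) be a sequence of real numbers with |mₙ| → ∞ and let (vₙ) be any sequence of nonnegative reals. Then for every bounded measurable set K ⊆ ℝ, the Gaussian measures satisfy gaussianReal(mₙ, vₙ)(K) → 0 as n → ∞. -/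
open MeasureTheory ProbabilityTheory Filter

lemma abs_sub_mul_gaussianPDFReal_le_one (μ : ℝ) (v : NNReal) (x : ℝ) :
    |x - μ| * gaussianPDFReal μ v x ≤ 1 := by
  rcases eq_or_ne v 0 with rfl | hv
  · simp
  have hv' : (0 : ℝ) < v := by positivity
  set s := √(2 * Real.pi * v) with hs
  have hs0 : 0 < s := by positivity
  have hs2 : s ^ 2 = 2 * Real.pi * v := Real.sq_sqrt (by positivity)
  set u := |x - μ| / s with hu
  have hexponent : (x - μ) ^ 2 / (2 * v) = Real.pi * u ^ 2 := by
    rw [hu, div_pow, hs2, sq_abs]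
    field_simp
  have hexp : u ≤ Real.exp (Real.pi * u ^ 2) := by
    nlinarith [Real.add_one_le_exp (Real.pi * u ^ 2), Real.pi_gt_three, sq_nonneg (u - 1),
      mul_nonneg (sub_nonneg.2 Real.pi_gt_three.le) (sq_nonneg u)]
  calc |x - μ| * gaussianPDFReal μ v x = u / Real.exp (Real.pi * u ^ 2) := by
        rw [gaussianPDFReal, neg_div, hexponent, Real.exp_neg, hu]
        ring
    _ ≤ 1 := (div_le_one (Real.exp_pos _)).2 hexp

lemma gaussianReal_le_of_le_abs_sub {μ d : ℝ} (v : NNReal) {s : Set ℝ} (hs : MeasurableSet s)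
    (hd : 0 < d) (h : ∀ x ∈ s, d ≤ |x - μ|) :
    gaussianReal μ v s ≤ ENNReal.ofReal d⁻¹ * volume s := by
  rcases eq_or_ne v 0 with rfl | hv
  · have hμ : μ ∉ s := fun hμ => by simpa using hd.trans_le (h μ hμ)
    simp [gaussianReal_zero_var, hs, hμ]
  rw [gaussianReal_apply μ hv, ← setLIntegral_const]
  refine setLIntegral_mono measurable_const fun x hx => ENNReal.ofReal_le_ofReal ?_
  rw [← one_div, le_div_iff₀' hd]
  exact (mul_le_mul_of_nonneg_right (h x hx) (gaussianPDFReal_nonneg μ v x)).trans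
    (abs_sub_mul_gaussianPDFReal_le_one μ v x)

theorem stmt16 (m : ℕ → ℝ) (hm : Tendsto (fun n => |m n|) atTop atTop)
    (v : ℕ → NNReal) (K : Set ℝ) (hKmeas : MeasurableSet K)
    (hKbdd : Bornology.IsBounded K) :
    Tendsto (fun n => gaussianReal (m n) (v n) K) atTop (nhds 0) := by
  obtain ⟨R, hR⟩ := hKbdd.exists_norm_le
  have hd : Tendsto (fun n => |m n| - R) atTop atTop := tendsto_atTop_add_const_right _ (-R) hm
  have hbound : Tendsto (fun n => ENNReal.ofReal (|m n| - R)⁻¹ * volume K) atTop (nhds 0) := by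
    simpa using ENNReal.Tendsto.mul_const
      (ENNReal.tendsto_ofReal (tendsto_inv_atTop_zero.comp hd))
      (Or.inr hKbdd.measure_lt_top.ne)
  refine tendsto_of_tendsto_of_tendsto_of_le_of_le' tendsto_const_nhds hbound
    (Eventually.of_forall fun _ => zero_le) ?_
  filter_upwards [hd.eventually_gt_atTop 0] with n hn
  refine gaussianReal_le_of_le_abs_sub (v n) hKmeas hn fun x hx => ?_
  have hx' : |x| ≤ R := hR x hx
  have := abs_sub_abs_le_abs_sub (m n) x
  rw [abs_sub_comm] at this
  linarith
end
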